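/- arXiv:1912.13055 — 2 statements merged into one kernel-verified Lean document; each statement's English description precedes it below -/
import Mathlib

section
/- The function G(x,w) = exp(−wx/(w(x−1)+1))/(w(x−1)+1), defined for real x and w with w(x−1)+1 ≠ 0, satisfies the partial differential equation x(x−1)²·∂G/∂x + (1−x²)·w·∂G/∂w + (1−2x)·G = ∂G/∂w at every point (x,w) with w(x−1)+1 ≠ 0, together with the initial condition G(x,0) = 1 for all real x. -/
/-- The generating function `G(x,w) = exp(−wx/(w(x−1)+1))/(w(x−1)+1)`. -/
noncomputable def G (x w : ℝ) : ℝ :=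
  Real.exp (-(w * x) / (w * (x - 1) + 1)) / (w * (x - 1) + 1)

theorem hasDerivAt_G_left {x w : ℝ} (h : w * (x - 1) + 1 ≠ 0) :
    HasDerivAt (fun t : ℝ => G t w)
      (G x w * (-(w * (2 - w + w * (x - 1))) / (w * (x - 1) + 1) ^ 2)) x := by
  have hD : HasDerivAt (fun t : ℝ => w * (t - 1) + 1) (w * 1) x :=
    (((hasDerivAt_id x).sub_const 1).const_mul w).add_const 1
  have hN : HasDerivAt (fun t : ℝ => -(w * t)) (-(w * 1)) x :=
    ((hasDerivAt_id x).const_mul w).neg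
  refine ((hN.div hD h).exp.div hD h).congr_deriv ?_
  simp only [G, Pi.div_apply]
  field_simp
  ring

theorem hasDerivAt_G_right {x w : ℝ} (h : w * (x - 1) + 1 ≠ 0) :
    HasDerivAt (fun t : ℝ => G x t)
      (G x w * (-(x + (x - 1) * (w * (x - 1) + 1)) / (w * (x - 1) + 1) ^ 2)) w := by
  have hD : HasDerivAt (fun t : ℝ => t * (x - 1) + 1) (1 * (x - 1)) w :=
    ((hasDerivAt_id w).mul_const (x - 1)).add_const 1
  have hN : HasDerivAt (fun t : ℝ => -(t * x)) (-(1 * x)) w :=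
    ((hasDerivAt_id w).mul_const x).neg
  refine ((hN.div hD h).exp.div hD h).congr_deriv ?_
  simp only [G, Pi.div_apply]
  field_simp
  ring

theorem G_satisfies_pde :
    (∀ x w : ℝ, w * (x - 1) + 1 ≠ 0 →
      x * (x - 1) ^ 2 * deriv (fun t : ℝ => G t w) x +
        (1 - x ^ 2) * w * deriv (fun t : ℝ => G x t) w +
        (1 - 2 * x) * G x w =
      deriv (fun t : ℝ => G x t) w) ∧
    (∀ x : ℝ, G x 0 = 1) := by
  refine ⟨fun x w h => ?_, fun x => by simp [G]⟩
  rw [(hasDerivAt_G_left h).deriv, (hasDerivAt_G_right h).deriv]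
  linear_combination
    -((1 - 2 * x) * G x w) * mul_inv_cancel₀ (pow_ne_zero 2 h)
end

section
/- For all integers n ≥ 0 and ℓ ≥ 0 with 2ℓ ≤ n, the recursively defined constants C_{n,ℓ} are given explicitly by C_{n,ℓ} = ((2ℓ−1)!!·n!·ℓ!·2^ℓ)/((2ℓ)!!·(n−2ℓ)!·(2ℓ)!). -/
open Finset

/-- The constants `C_{k,ℓ}` defined by the recursion `C_{0,0} = 1`,
`C_{k,ℓ} = 0` for `ℓ > ⌊k/2⌋` (and for negative indices), and otherwise
`C_{k,ℓ} = C_{k−1,ℓ} + (k − 2ℓ + 1)·C_{k−1,ℓ−1}`. -/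
noncomputable def Ckl : ℕ → ℕ → ℝ
  | 0, 0 => 1
  | 0, _ + 1 => 0
  | k + 1, 0 => Ckl k 0
  | k + 1, l + 1 =>
    if 2 * (l + 1) > k + 1 then 0
    else Ckl k (l + 1) + (((k : ℝ) + 1) - 2 * ((l : ℝ) + 1) + 1) * Ckl k l

theorem Ckl_eq_zero {n l : ℕ} (h : n < 2 * l) : Ckl n l = 0 := by
  cases n <;> cases l <;> simp_all [Ckl]

theorem Ckl_mul_factorial (n : ℕ) : ∀ l m : ℕ, n = m + 2 * l →
    Ckl n l * ((m.factorial : ℝ) * 2 ^ l * (l.factorial : ℝ)) = (n.factorial : ℝ) := by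
  induction n with
  | zero =>
    intro l m h
    obtain ⟨rfl, rfl⟩ : m = 0 ∧ l = 0 := by omega
    simp [Ckl]
  | succ k ih =>
    intro l m h
    cases l with
    | zero =>
      obtain rfl : m = k + 1 := by omega
      have h0 := ih 0 k (by omega)
      simp only [Ckl, Nat.factorial_succ, Nat.factorial_zero, pow_zero] at h0 ⊢
      push_cast at h0 ⊢
      linear_combination ((k : ℝ) + 1) * h0
    | succ l =>
      have hrec : Ckl (k + 1) (l + 1) = Ckl k (l + 1) + ((m : ℝ) + 1) * Ckl k l := by
        have hk : (k : ℝ) + 1 = m + 2 * (l + 1) := by exact_mod_cast h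
        rw [Ckl, if_neg (by omega), hk]
        ring
      have hl := ih l (m + 1) (by omega)
      rw [hrec]
      cases m with
      | zero =>
        obtain rfl : k = 2 * l + 1 := by omega
        rw [Ckl_eq_zero (by omega : 2 * l + 1 < 2 * (l + 1)), Nat.factorial_succ (2 * l + 1)]
        simp only [Nat.factorial_succ l, Nat.factorial_zero, zero_add, Nat.factorial_one] at hl ⊢
        push_cast at hl ⊢
        linear_combination (2 * (l : ℝ) + 2) * hl
      | succ m =>
        have hl' := ih (l + 1) m (by omega)
        have hk : (k : ℝ) = m + 2 * (l + 1) := by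
          exact_mod_cast (by omega : k = m + 2 * (l + 1))
        simp only [Nat.factorial_succ] at hl hl' ⊢
        push_cast at hl hl' ⊢
        rw [hk]
        linear_combination ((m : ℝ) + 1) * hl' + (2 * (l : ℝ) + 2) * hl

theorem factorial_two_mul_eq (l : ℕ) :
    (2 * l).factorial = (2 * l).doubleFactorial * (2 * l - 1).doubleFactorial := by
  cases l with
  | zero => simp
  | succ l => exact Nat.factorial_eq_mul_doubleFactorial (2 * l + 1)

theorem Ckl_explicit_formula (n l : ℕ) (h : 2 * l ≤ n) :
    Ckl n l =
      ((Nat.doubleFactorial (2 * l - 1) : ℝ) * (Nat.factorial n : ℝ) *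
          (Nat.factorial l : ℝ) * 2 ^ l) /
        ((Nat.doubleFactorial (2 * l) : ℝ) * (Nat.factorial (n - 2 * l) : ℝ) *
          (Nat.factorial (2 * l) : ℝ)) := by
  have hmain := Ckl_mul_factorial n l (n - 2 * l) (by omega)
  have hodd : ((2 * l - 1).doubleFactorial : ℝ) ≠ 0 := by
    exact_mod_cast (Nat.doubleFactorial_pos _).ne'
  have hfac : ((n - 2 * l).factorial : ℝ) ≠ 0 := by
    exact_mod_cast Nat.factorial_ne_zero _
  have hl : (l.factorial : ℝ) ≠ 0 := by
    exact_mod_cast Nat.factorial_ne_zero _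
  rw [factorial_two_mul_eq, Nat.doubleFactorial_two_mul, ← hmain]
  push_cast
  field_simp
end
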